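/- Let E ⊆ Sym²(ℝⁿ) be a linear subspace with E ∩ 𝒫 = {0}, let S = E^⊥, and let 𝒫⁺ = E + 𝒫 be the minimal subequation with edge E. Then the interior of the polar cone (𝒫⁺)₊ relative to the subspace S satisfies Int_S (𝒫⁺)₊ = S ∩ Int 𝒫; in particular every matrix in the relative interior of (𝒫⁺)₊ is positive definite. -/

import Mathlib

open Matrix Set Pointwise

noncomputable section

/-- `Sym²(ℝⁿ)`: the space of real symmetric `n × n` matrices,
realized as the self-adjoint elements of the matrix algebra. -/
abbrev SymMat (n : ℕ) : Type := ↥(selfAdjoint (Matrix (Fin n) (Fin n) ℝ))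

namespace SymMat

variable {n : ℕ}

/-- The trace inner product `⟨A, B⟩ = tr (A * B)` on `Sym²(ℝⁿ)`. -/
def tinner (A B : SymMat n) : ℝ :=
  ((A : Matrix (Fin n) (Fin n) ℝ) * (B : Matrix (Fin n) (Fin n) ℝ)).trace

/-- `𝒫`: the closed convex cone of positive semidefinite matrices. -/
def Psd (n : ℕ) : Set (SymMat n) :=
  {A | (A : Matrix (Fin n) (Fin n) ℝ).PosSemidef}

/-- The set of positive definite matrices (= `Int 𝒫`). -/
def Pd (n : ℕ) : Set (SymMat n) :=
  {A | (A : Matrix (Fin n) (Fin n) ℝ).PosDef}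

/-- A convex cone subequation: a closed convex cone `F ⊆ Sym²(ℝⁿ)` which is a nonempty
proper subset and satisfies the positivity condition `F + 𝒫 = F`. -/
structure IsSubequation (F : Set (SymMat n)) : Prop where
  nonempty : F.Nonempty
  proper : F ≠ Set.univ
  isClosed : IsClosed F
  convex : Convex ℝ F
  cone : ∀ t : ℝ, 0 ≤ t → ∀ A ∈ F, t • A ∈ F
  positivity : ∀ A ∈ F, ∀ P ∈ Psd n, A + P ∈ F

/-- The polar cone `F₊ = {B : ⟨A,B⟩ ≥ 0 ∀ A ∈ F}`. -/
def polarCone (F : Set (SymMat n)) : Set (SymMat n) :=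
  {B | ∀ A ∈ F, 0 ≤ tinner A B}

/-- The edge `E = F ∩ (−F)`. -/
def edge (F : Set (SymMat n)) : Set (SymMat n) := F ∩ (-F)

/-- Orthogonal complement (as a set) with respect to the trace inner product. -/
def orthSet (E : Set (SymMat n)) : Set (SymMat n) :=
  {B | ∀ A ∈ E, tinner A B = 0}

/-- `P_e = e eᵀ`, orthogonal projection onto the line spanned by `e`, as a symmetric matrix. -/
def lineProj (e : EuclideanSpace ℝ (Fin n)) : SymMat n :=
  ⟨Matrix.vecMulVec (WithLp.equiv 2 (Fin n → ℝ) e) (WithLp.equiv 2 (Fin n → ℝ) e), by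
    refine selfAdjoint.mem_iff.mpr ?_
    ext i j
    simp [Matrix.conjTranspose_apply, Matrix.vecMulVec_apply, mul_comm]⟩

/-- The matrix `P_W` of the orthogonal projection onto a subspace `W ⊆ ℝⁿ`. -/
def projMat (W : Submodule ℝ (EuclideanSpace ℝ (Fin n))) : Matrix (Fin n) (Fin n) ℝ :=
  Matrix.toEuclideanLin.symm ((W.subtypeL.comp (W.orthogonalProjectionOnto)).toLinearMap)

/-- `Sym²(W) = {A : A = P_W A P_W}`. -/
def symOn (W : Submodule ℝ (EuclideanSpace ℝ (Fin n))) : Set (SymMat n) :=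
  {A | (A : Matrix (Fin n) (Fin n) ℝ) = projMat W * A * projMat W}

/-- The restriction `F_W = {P_W A P_W : A ∈ F}` of `F` to `W` (inside `Sym²(W)`). -/
def restrictTo (F : Set (SymMat n)) (W : Submodule ℝ (EuclideanSpace ℝ (Fin n))) :
    Set (SymMat n) :=
  {B | ∃ A ∈ F, (B : Matrix (Fin n) (Fin n) ℝ) = projMat W * A * projMat W}

/-- `F` is extremely degenerate: the polar cone only involves the variables of some
proper subspace `W ⊊ ℝⁿ`. -/
def IsExtremelyDegenerate (F : Set (SymMat n)) : Prop :=
  ∃ W : Submodule ℝ (EuclideanSpace ℝ (Fin n)), W ≠ ⊤ ∧ polarCone F ⊆ symOn W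

/-- `F` is (dimensionally) complete. -/
def IsComplete (F : Set (SymMat n)) : Prop := ¬ IsExtremelyDegenerate F

/-- The interior of `F` relative to `S`. -/
def relInt (S F : Set (SymMat n)) : Set (SymMat n) :=
  {B | B ∈ S ∧ ∃ U : Set (SymMat n), IsOpen U ∧ B ∈ U ∧ U ∩ S ⊆ F}

/-- The support of `F`: the intersection of all subspaces `W'` with `F₊ ⊆ Sym²(W')`. -/
def support (F : Set (SymMat n)) : Submodule ℝ (EuclideanSpace ℝ (Fin n)) :=
  sInf {W | polarCone F ⊆ symOn W}

/-- The polar cone of `G` taken within `Sym²(W)`. -/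
def polarIn (G : Set (SymMat n)) (W : Submodule ℝ (EuclideanSpace ℝ (Fin n))) :
    Set (SymMat n) :=
  {B | B ∈ symOn W ∧ ∀ A ∈ G, 0 ≤ tinner A B}

end SymMat

namespace SymMat

/-- `⟨A, x xᵀ⟩ = xᵀ A x`. -/
lemma trace_vecMulVec_mul_aux {n : ℕ} (x : Fin n → ℝ) (B : Matrix (Fin n) (Fin n) ℝ) :
    (Matrix.vecMulVec x x * B).trace = x ⬝ᵥ (B *ᵥ x) := by
  rw [Matrix.trace_mul_comm, Matrix.mul_vecMulVec, Matrix.trace_vecMulVec, dotProduct_comm]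

/-- The trace of a product of positive semidefinite matrices is nonnegative. -/
lemma trace_mul_nonneg_aux {n : ℕ} {A B : Matrix (Fin n) (Fin n) ℝ}
    (hA : A.PosSemidef) (hB : B.PosSemidef) : 0 ≤ (A * B).trace := by
  obtain ⟨m, v, rfl⟩ := Matrix.posSemidef_iff_eq_sum_vecMulVec.1 hA
  rw [Finset.sum_mul, Matrix.trace_sum]
  refine Finset.sum_nonneg fun i _ => ?_
  have h := trace_vecMulVec_mul_aux (v i) B
  simp only [star_trivial] at *
  rw [h]
  simpa using hB.dotProduct_mulVec_nonneg (v i)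

/-- The rank-one matrix `x xᵀ`. -/
def rankOne {n : ℕ} (x : Fin n → ℝ) : SymMat n :=
  ⟨Matrix.vecMulVec x x, by
    refine selfAdjoint.mem_iff.mpr ?_
    ext i j
    simp [Matrix.star_apply, Matrix.vecMulVec_apply, mul_comm]⟩

lemma rankOne_mem {n : ℕ} (x : Fin n → ℝ) : rankOne x ∈ Psd n := by
  simpa [Psd, rankOne] using Matrix.posSemidef_vecMulVec_self_star x

lemma herm_aux {n : ℕ} (B : SymMat n) : (B : Matrix (Fin n) (Fin n) ℝ).IsHermitian := B.2

lemma polar_eq {n : ℕ} (E : Submodule ℝ (SymMat n)) :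
    polarCone ((E : Set (SymMat n)) + Psd n) = orthSet (E : Set (SymMat n)) ∩ Psd n := by
  ext B
  constructor
  · intro h
    have h0 : (0 : SymMat n) ∈ Psd n := by
      simpa [Psd] using (Matrix.PosSemidef.zero (n := Fin n) (R := ℝ))
    refine ⟨fun A hA => ?_, ?_⟩
    · have h1 := h A ⟨A, hA, 0, h0, add_zero A⟩
      have h2 := h (-A) ⟨-A, E.neg_mem hA, 0, h0, add_zero _⟩
      simp [tinner] at h1 h2 ⊢
      linarith
    · refine Matrix.PosSemidef.of_dotProduct_mulVec_nonneg (herm_aux B) fun x => ?_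
      have h1 := h (rankOne x) ⟨0, E.zero_mem, rankOne x, rankOne_mem x, zero_add _⟩
      rw [tinner] at h1
      simpa [rankOne, trace_vecMulVec_mul_aux] using h1
  · rintro ⟨h1, h2⟩ _ ⟨A, hA, P, hP, rfl⟩
    have h3 := h1 A hA
    have h4 := trace_mul_nonneg_aux hP h2
    simp only [tinner, AddSubgroup.coe_add, add_mul, Matrix.trace_add] at *
    linarith

lemma posDef_mem_interior {n : ℕ} (B : SymMat n)
    (hB : (B : Matrix (Fin n) (Fin n) ℝ).PosDef) : B ∈ interior (Psd n) := by
  rw [mem_interior_iff_mem_nhds]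
  have hK : IsCompact (Metric.sphere (0 : Fin n → ℝ) 1) := isCompact_sphere _ _
  have key := hK.eventually_forall_of_forall_eventually (x₀ := B)
    (P := fun (C : SymMat n) x => 0 < x ⬝ᵥ ((C : Matrix (Fin n) (Fin n) ℝ) *ᵥ x)) (by
      intro y hy
      have hc : Continuous fun z : SymMat n × (Fin n → ℝ) =>
          z.2 ⬝ᵥ ((z.1 : Matrix (Fin n) (Fin n) ℝ) *ᵥ z.2) := by
        refine Continuous.dotProduct continuous_snd ?_
        exact Continuous.matrix_mulVec (continuous_subtype_val.comp continuous_fst) continuous_snd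
      refine hc.continuousAt.eventually (lt_mem_nhds ?_)
      have hy0 : y ≠ 0 := by
        rintro rfl
        simp at hy
      simpa using hB.dotProduct_mulVec_pos hy0)
  filter_upwards [key] with C hC
  refine Matrix.PosSemidef.of_dotProduct_mulVec_nonneg (herm_aux C) fun x => ?_
  by_cases hx : x = 0
  · simp [hx]
  have hn : 0 < ‖x‖ := norm_pos_iff.2 hx
  have h1 := hC (‖x‖⁻¹ • x) (by simp [norm_smul, hn.ne'])
  simp only [Matrix.mulVec_smul, dotProduct_smul, smul_dotProduct, smul_eq_mul] at h1
  rw [← mul_assoc] at h1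
  have h2 := pos_of_mul_pos_right h1 (by positivity)
  simpa using h2.le

section
open scoped Matrix.Norms.Elementwise

lemma exists_posDef {n : ℕ} (E : Submodule ℝ (SymMat n))
    (hE : (E : Set (SymMat n)) ∩ Psd n = {0}) :
    ∃ A : SymMat n, A ∈ orthSet (E : Set (SymMat n)) ∧
      (A : Matrix (Fin n) (Fin n) ℝ).PosDef := by
  set s : Set (Matrix (Fin n) (Fin n) ℝ) :=
    Set.image (fun x : Fin n → ℝ => Matrix.vecMulVec x x) (Metric.sphere (0 : Fin n → ℝ) 1) with hs
  have hsc : IsCompact s := (isCompact_sphere _ _).image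
    (Continuous.matrix_vecMulVec continuous_id continuous_id)
  have hKc : IsCompact (closure (convexHull ℝ s)) :=
    (isBounded_convexHull.2 hsc.isBounded).isCompact_closure
  set T : Set (Matrix (Fin n) (Fin n) ℝ) :=
    {A | A.IsHermitian ∧ (∀ x : Fin n → ℝ, 0 ≤ x ⬝ᵥ (A *ᵥ x)) ∧ 1 ≤ A.trace} with hT
  have hTclosed : IsClosed T := by
    refine IsClosed.inter (isClosed_eq (by fun_prop) continuous_id) (IsClosed.inter ?_ ?_)
    · change IsClosed {A : Matrix (Fin n) (Fin n) ℝ | ∀ x : Fin n → ℝ, 0 ≤ x ⬝ᵥ (A *ᵥ x)}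
      rw [Set.ofPred_forall]
      refine isClosed_iInter fun x => isClosed_le continuous_const ?_
      exact Continuous.dotProduct continuous_const
        (Continuous.matrix_mulVec continuous_id continuous_const)
    · exact isClosed_le continuous_const (Continuous.matrix_trace continuous_id)
  have hTconv : Convex ℝ T := by
    rintro A ⟨hA1, hA2, hA3⟩ B ⟨hB1, hB2, hB3⟩ a b ha hb hab
    refine ⟨?_, fun x => ?_, ?_⟩
    · simp only [Matrix.IsHermitian, Matrix.conjTranspose_add, Matrix.conjTranspose_smul] at *
      rw [hA1, hB1, star_trivial, star_trivial]
    · simp only [Matrix.add_mulVec, Matrix.smul_mulVec, dotProduct_add, dotProduct_smul,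
        smul_eq_mul]
      have := hA2 x
      have := hB2 x
      positivity
    · simp only [Matrix.trace_add, Matrix.trace_smul, smul_eq_mul]
      nlinarith
  have hsT : s ⊆ T := by
    rintro _ ⟨x, hx, rfl⟩
    have hp := rankOne_mem x
    refine ⟨hp.isHermitian, fun y => by simpa [rankOne] using hp.dotProduct_mulVec_nonneg y, ?_⟩
    rw [Matrix.trace_vecMulVec]
    have hx1 : ‖x‖ = 1 := by simpa using hx
    by_contra! hlt
    have : ‖x‖ < 1 := by
      rw [pi_norm_lt_iff one_pos]
      intro i
      have h1 : x i * x i ≤ x ⬝ᵥ x :=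
        Finset.single_le_sum (f := fun i => x i * x i) (fun i _ => mul_self_nonneg _)
          (Finset.mem_univ i)
      rw [Real.norm_eq_abs, abs_lt]
      constructor <;> nlinarith
    linarith
  have hKT : closure (convexHull ℝ s) ⊆ T :=
    closure_minimal (convexHull_min hsT hTconv) hTclosed
  set L : SymMat n →ₗ[ℝ] Matrix (Fin n) (Fin n) ℝ :=
    { toFun := fun A => A, map_add' := fun _ _ => rfl, map_smul' := fun _ _ => rfl } with hL
  set E' := E.map L with hE'
  have hdisj : Disjoint (closure (convexHull ℝ s)) (E' : Set (Matrix (Fin n) (Fin n) ℝ)) := by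
    rw [Set.disjoint_left]
    rintro A hA ⟨A', hA', rfl⟩
    obtain ⟨h1, h2, h3⟩ := hKT hA
    have : A' ∈ (E : Set (SymMat n)) ∩ Psd n :=
      ⟨hA', Matrix.PosSemidef.of_dotProduct_mulVec_nonneg h1 fun x => h2 x⟩
    rw [hE, Set.mem_singleton_iff] at this
    subst this
    simp at h3
    linarith
  haveI : LocallyConvexSpace ℝ (Matrix (Fin n) (Fin n) ℝ) :=
    inferInstanceAs (LocallyConvexSpace ℝ (Fin n → Fin n → ℝ))
  obtain ⟨f, u, v, hfu, huv, hfv⟩ := geometric_hahn_banach_compact_closed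
    (convex_convexHull ℝ s).closure hKc E'.convex E'.closed_of_finiteDimensional hdisj
  have hv0 : v < 0 := by simpa using hfv 0 E'.zero_mem
  have hf0 : ∀ A ∈ E', f A = 0 := by
    intro A hA
    by_contra hne
    have := hfv ((v / f A) • A) (E'.smul_mem _ hA)
    rw [map_smul, smul_eq_mul, div_mul_cancel₀ _ hne] at this
    exact lt_irrefl _ this
  have hfneg : ∀ A ∈ s, f A < 0 := fun A hA =>
    ((hfu A (subset_closure (subset_convexHull ℝ s hA))).trans huv).trans hv0
  have hrep : ∀ A : Matrix (Fin n) (Fin n) ℝ,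
      f A = ∑ i, ∑ j, A i j * f (Matrix.single i j 1) := by
    intro A
    conv_lhs => rw [Matrix.matrix_eq_sum_single A]
    simp only [map_sum]
    refine Finset.sum_congr rfl fun i _ => Finset.sum_congr rfl fun j _ => ?_
    rw [← smul_eq_mul, ← map_smul, Matrix.smul_single, smul_eq_mul, mul_one]
  set C : Matrix (Fin n) (Fin n) ℝ :=
    Matrix.of fun i j => - (f (Matrix.single i j 1) + f (Matrix.single j i 1)) with hC
  have hCh : C.IsHermitian := by
    ext i j
    simp [hC]
    ring
  have htr : ∀ A : Matrix (Fin n) (Fin n) ℝ, A.IsHermitian → (A * C).trace = - (2 * f A) := by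
    intro A hA
    have hA' : ∀ i j, A j i = A i j := fun i j => by simpa using hA.apply i j
    have h2 : f A = ∑ i, ∑ j, A i j * f (Matrix.single j i 1) := by
      rw [hrep A, Finset.sum_comm]
      simp only [hA']
    have h3 : (A * C).trace = - (f A + f A) := by
      nth_rewrite 1 [hrep A]
      rw [h2]
      simp only [Matrix.trace, Matrix.diag, Matrix.mul_apply, hC, Matrix.of_apply,
        ← Finset.sum_add_distrib, ← Finset.sum_neg_distrib]
      refine Finset.sum_congr rfl fun i _ => Finset.sum_congr rfl fun j _ => ?_
      ring
    rw [h3]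
    ring
  refine ⟨⟨C, hCh⟩, fun A hA => ?_, ?_⟩
  · have h1 := htr A (herm_aux A)
    have h2 : f A = 0 := hf0 _ ⟨A, hA, rfl⟩
    rw [h2] at h1
    simpa [tinner] using h1
  · refine Matrix.PosDef.of_dotProduct_mulVec_pos hCh fun x hx => ?_
    have hn : 0 < ‖x‖ := norm_pos_iff.2 hx
    have h1 := hfneg _ ⟨‖x‖⁻¹ • x, by simp [norm_smul, hn.ne'], rfl⟩
    have h2 := htr _ (herm_aux (rankOne (‖x‖⁻¹ • x)))
    have h3 := trace_vecMulVec_mul_aux (‖x‖⁻¹ • x) C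
    simp only [rankOne] at h2
    rw [h3] at h2
    simp only [Matrix.mulVec_smul, dotProduct_smul, smul_dotProduct, smul_eq_mul] at h2
    rw [← mul_assoc] at h2
    have h4 : 0 < ‖x‖⁻¹ * ‖x‖⁻¹ * (x ⬝ᵥ C *ᵥ x) := by
      rw [h2]
      linarith
    simpa using pos_of_mul_pos_right h4 (by positivity)

end

lemma relInt_posDef {n : ℕ} (E : Submodule ℝ (SymMat n))
    (hE : (E : Set (SymMat n)) ∩ Psd n = {0}) (B : SymMat n)
    (hB : B ∈ relInt (orthSet (E : Set (SymMat n)))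
      (polarCone ((E : Set (SymMat n)) + Psd n))) :
    (B : Matrix (Fin n) (Fin n) ℝ).PosDef := by
  obtain ⟨hBS, U, hU, hBU, hUS⟩ := hB
  obtain ⟨A, hA, hApos⟩ := exists_posDef E hE
  have hc : Continuous fun t : ℝ => B - t • A := by
    refine Continuous.subtype_mk (?_ : Continuous fun t : ℝ =>
      (B : Matrix (Fin n) (Fin n) ℝ) - t • (A : Matrix (Fin n) (Fin n) ℝ)) _
    fun_prop
  have hev : ∀ᶠ t : ℝ in nhds 0, B - t • A ∈ U :=
    hc.continuousAt.eventually (hU.mem_nhds (by simpa using hBU))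
  obtain ⟨t, htU, ht⟩ := ((hev.filter_mono nhdsWithin_le_nhds).and
    (self_mem_nhdsWithin : Set.Ioi (0 : ℝ) ∈ nhdsWithin 0 (Set.Ioi 0))).exists
  have hS : B - t • A ∈ orthSet (E : Set (SymMat n)) := by
    intro D hD
    have h1 := hBS D hD
    have h2 := hA D hD
    simp only [tinner, AddSubgroup.coe_sub, selfAdjoint.val_smul, mul_sub, Matrix.trace_sub,
      Matrix.mul_smul, Matrix.trace_smul] at *
    simp [h1, h2]
  have hpol := hUS ⟨htU, hS⟩
  rw [polar_eq] at hpol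
  have h3 := (hApos.smul (show (0 : ℝ) < t from ht)).add_posSemidef hpol.2
  simpa using h3

end SymMat

open SymMat in
theorem relInt_polar_minimal_subequation {n : ℕ} (E : Submodule ℝ (SymMat n))
    (hE : (E : Set (SymMat n)) ∩ Psd n = {0}) :
    relInt (orthSet (E : Set (SymMat n))) (polarCone ((E : Set (SymMat n)) + Psd n)) =
      orthSet (E : Set (SymMat n)) ∩ interior (Psd n) ∧
    ∀ B ∈ relInt (orthSet (E : Set (SymMat n))) (polarCone ((E : Set (SymMat n)) + Psd n)),
      (B : Matrix (Fin n) (Fin n) ℝ).PosDef := by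
  refine ⟨Set.Subset.antisymm (fun B hB => ⟨hB.1, ?_⟩) (fun B hB => ⟨hB.1, interior (Psd n),
    isOpen_interior, hB.2, ?_⟩), relInt_posDef E hE⟩
  · exact posDef_mem_interior B (relInt_posDef E hE B hB)
  · rw [polar_eq]
    exact fun C hC => ⟨hC.2, interior_subset hC.1⟩
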